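/- arXiv:2205.05780 — 3 statements merged into one kernel-verified Lean document; each statement's English description precedes it below -/
import Mathlib

section
/- Let p ≥ 2 and t, h > 0, and define F : [0,∞) × [0,∞) → ℝ by F(u,v) = u^p + v^p − |u−v|^{p−2}(u−v)(G_{t,h}(u) − G_{t,h}(v)). Then F is continuous, F(0,0) = 0, F(u,v) ≥ 0 for all u, v ≥ 0, and F(u₂,v₂) + F(u₁,v₁) ≥ F(u₂,v₁) + F(u₁,v₂) whenever 0 ≤ u₁ ≤ u₂ and 0 ≤ v₁ ≤ v₂. -/
open MeasureTheory Real Set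
open scoped ENNReal NNReal

noncomputable section

/-- Euclidean space `ℝ^N`. -/
abbrev Euc (N : ℕ) := EuclideanSpace ℝ (Fin N)

/-- The truncation `G_{t,h}`: `0` for `θ ≤ t`, `θ - t` for `t < θ ≤ t+h`, `h` for `θ > t+h`. -/
def trunc (t h θ : ℝ) : ℝ := if θ ≤ t then 0 else if θ ≤ t + h then θ - t else h

/-- The function `F(u,v) = u^p + v^p - |u-v|^{p-2}(u-v)(G_{t,h}(u) - G_{t,h}(v))`. -/
def Ffun (p t h u v : ℝ) : ℝ :=
  u ^ p + v ^ p - |u - v| ^ (p - 2) * (u - v) * (trunc t h u - trunc t h v)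

theorem trunc_eq_min_max {t h : ℝ} (hh : 0 < h) (θ : ℝ) :
    trunc t h θ = min (max (θ - t) 0) h := by
  unfold trunc
  split_ifs with h1 h2
  · rw [max_eq_right (by linarith), min_eq_left hh.le]
  · rw [max_eq_left (by linarith), min_eq_left (by linarith)]
  · rw [max_eq_left (by linarith), min_eq_right (by linarith)]

theorem monotone_trunc {t h : ℝ} (hh : 0 < h) : Monotone (trunc t h) := by
  intro x y hxy
  simp only [trunc_eq_min_max hh]
  gcongr

theorem continuous_trunc {t h : ℝ} (hh : 0 < h) : Continuous (trunc t h) := by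
  simp only [funext (trunc_eq_min_max (t := t) hh)]
  fun_prop

theorem trunc_zero {t h : ℝ} (ht : 0 < t) : trunc t h 0 = 0 := by
  simp [trunc, ht.le]

theorem trunc_le_self {t h θ : ℝ} (ht : 0 < t) (hθ : 0 ≤ θ) : trunc t h θ ≤ θ := by
  unfold trunc
  split_ifs <;> linarith

/-- The odd power `x ↦ |x|^(p-2) x`. -/
def oddPow (p x : ℝ) : ℝ := |x| ^ (p - 2) * x

theorem oddPow_neg (p x : ℝ) : oddPow p (-x) = -oddPow p x := by
  simp [oddPow]

theorem oddPow_of_nonneg {p x : ℝ} (hp : 2 ≤ p) (hx : 0 ≤ x) : oddPow p x = x ^ (p - 1) := by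
  rw [oddPow, abs_of_nonneg hx, ← rpow_add_one' hx (by linarith)]
  ring_nf

theorem oddPow_mul_self {p x : ℝ} (hp : 2 ≤ p) (hx : 0 ≤ x) : oddPow p x * x = x ^ p := by
  rw [oddPow_of_nonneg hp hx, ← rpow_add_one' hx (by linarith)]
  ring_nf

theorem oddPow_nonneg {p x : ℝ} (hx : 0 ≤ x) : 0 ≤ oddPow p x := by
  unfold oddPow
  positivity

theorem monotone_oddPow {p : ℝ} (hp : 2 ≤ p) : Monotone (oddPow p) := by
  have key : ∀ x y : ℝ, 0 ≤ x → x ≤ y → oddPow p x ≤ oddPow p y := fun x y hx hxy => by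
    rw [oddPow_of_nonneg hp hx, oddPow_of_nonneg hp (hx.trans hxy)]
    exact rpow_le_rpow hx hxy (by linarith)
  intro x y hxy
  rcases le_total 0 x with hx | hx
  · exact key x y hx hxy
  · rcases le_total 0 y with hy | hy
    · have := oddPow_nonneg (p := p) (neg_nonneg.2 hx)
      rw [oddPow_neg] at this
      linarith [oddPow_nonneg (p := p) hy]
    · have := key (-y) (-x) (neg_nonneg.2 hy) (neg_le_neg hxy)
      rw [oddPow_neg, oddPow_neg] at this
      linarith

theorem convexOn_oddPow {p : ℝ} (hp : 2 ≤ p) : ConvexOn ℝ (Ici 0) (oddPow p) :=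
  (convexOn_rpow (by linarith : 1 ≤ p - 1)).congr
    fun _ hx => (oddPow_of_nonneg hp hx).symm

/-- Increments of a convex function on the half-line are nondecreasing. -/
theorem ConvexOn.add_le_add_of_nonneg {f : ℝ → ℝ} (hf : ConvexOn ℝ (Ici 0) f) {a d e : ℝ}
    (ha : 0 ≤ a) (hd : 0 ≤ d) (he : 0 ≤ e) :
    f (a + d) + f (a + e) ≤ f (a + d + e) + f a := by
  rcases (add_nonneg hd he).eq_or_lt with h0 | h0
  · obtain rfl : d = 0 := by linarith
    obtain rfl : e = 0 := by linarith
    simp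
  · have ha' : a ∈ Ici (0 : ℝ) := ha
    have hb' : a + d + e ∈ Ici (0 : ℝ) := by simp only [mem_Ici]; linarith
    have hsum : e / (d + e) + d / (d + e) = 1 := by field_simp; ring
    have h1 := hf.2 ha' hb' (div_nonneg he h0.le) (div_nonneg hd h0.le) hsum
    have h2 := hf.2 hb' ha' (div_nonneg he h0.le) (div_nonneg hd h0.le) hsum
    simp only [smul_eq_mul] at h1 h2
    have e1 : e / (d + e) * a + d / (d + e) * (a + d + e) = a + d := by field_simp; ring
    have e2 : e / (d + e) * (a + d + e) + d / (d + e) * a = a + e := by field_simp; ring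
    rw [e1] at h1
    rw [e2] at h2
    linear_combination h1 + h2 + (f (a + d + e) + f a) * hsum

theorem oddPow_mul_sub_submodular_of_le {p : ℝ} (hp : 2 ≤ p) {g : ℝ → ℝ} (hg : Monotone g)
    {u₁ u₂ v₁ v₂ : ℝ} (hu : u₁ ≤ u₂) (hv : v₁ ≤ v₂) (huv : v₂ ≤ u₂) :
    oddPow p (u₂ - v₂) * (g u₂ - g v₂) + oddPow p (u₁ - v₁) * (g u₁ - g v₁) ≤
      oddPow p (u₂ - v₁) * (g u₂ - g v₁) + oddPow p (u₁ - v₂) * (g u₁ - g v₂) := by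
  have m := monotone_oddPow hp
  have h1 : oddPow p (u₂ - v₂) ≤ oddPow p (u₂ - v₁) := m (by linarith)
  have h2 : oddPow p (u₁ - v₁) ≤ oddPow p (u₂ - v₁) := m (by linarith)
  have h3 : oddPow p (u₁ - v₂) ≤ oddPow p (u₁ - v₁) := m (by linarith)
  have h4 : oddPow p (u₁ - v₂) ≤ oddPow p (u₂ - v₂) := m (by linarith)
  rcases le_total v₂ u₁ with h | h
  · have h5 := (convexOn_oddPow hp).add_le_add_of_nonneg (sub_nonneg.2 h) (sub_nonneg.2 hu)
      (sub_nonneg.2 hv)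
    rw [show u₁ - v₂ + (u₂ - u₁) = u₂ - v₂ by ring, show u₁ - v₂ + (v₂ - v₁) = u₁ - v₁ by ring,
      show u₂ - v₂ + (v₂ - v₁) = u₂ - v₁ by ring] at h5
    linarith [mul_nonneg (sub_nonneg.2 (hg hu)) (sub_nonneg.2 h1),
      mul_nonneg (sub_nonneg.2 (hg h)) (sub_nonneg.2 h5),
      mul_nonneg (sub_nonneg.2 (hg hv)) (sub_nonneg.2 h2)]
  · rcases le_total v₁ u₁ with h' | h'
    · linarith [mul_nonneg (sub_nonneg.2 (hg huv)) (sub_nonneg.2 h1),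
        mul_nonneg (sub_nonneg.2 (hg h)) (sub_nonneg.2 (h3.trans h2)),
        mul_nonneg (sub_nonneg.2 (hg h')) (sub_nonneg.2 h2)]
    · linarith [mul_nonneg (sub_nonneg.2 (hg huv)) (sub_nonneg.2 h1),
        mul_nonneg (sub_nonneg.2 (hg hv)) (sub_nonneg.2 (h3.trans h2)),
        mul_nonneg (sub_nonneg.2 (hg h')) (sub_nonneg.2 h3)]

/-- For monotone `g`, the function `(u, v) ↦ |u-v|^(p-2) (u-v) (g u - g v)` is submodular. -/
theorem oddPow_mul_sub_submodular {p : ℝ} (hp : 2 ≤ p) {g : ℝ → ℝ} (hg : Monotone g)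
    {u₁ u₂ v₁ v₂ : ℝ} (hu : u₁ ≤ u₂) (hv : v₁ ≤ v₂) :
    oddPow p (u₂ - v₂) * (g u₂ - g v₂) + oddPow p (u₁ - v₁) * (g u₁ - g v₁) ≤
      oddPow p (u₂ - v₁) * (g u₂ - g v₁) + oddPow p (u₁ - v₂) * (g u₁ - g v₂) := by
  rcases le_total v₂ u₂ with h | h
  · exact oddPow_mul_sub_submodular_of_le hp hg hu hv h
  · have := oddPow_mul_sub_submodular_of_le hp hg hv hu h
    simp only [← neg_sub u₁, ← neg_sub u₂, oddPow_neg] at this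
    linarith

theorem Ffun_supermodular {p t h : ℝ} (hp : 2 ≤ p) (hh : 0 < h) {u₁ u₂ v₁ v₂ : ℝ}
    (hu : u₁ ≤ u₂) (hv : v₁ ≤ v₂) :
    Ffun p t h u₂ v₁ + Ffun p t h u₁ v₂ ≤ Ffun p t h u₂ v₂ + Ffun p t h u₁ v₁ := by
  have := oddPow_mul_sub_submodular hp (monotone_trunc (t := t) hh) hu hv
  unfold oddPow at this
  unfold Ffun
  linarith

theorem Ffun_comm (p t h u v : ℝ) : Ffun p t h u v = Ffun p t h v u := by
  unfold Ffun
  rw [abs_sub_comm u v]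
  ring

theorem Ffun_zero_right_nonneg {p t h u : ℝ} (hp : 2 ≤ p) (ht : 0 < t) (hu : 0 ≤ u) :
    0 ≤ Ffun p t h u 0 := by
  have h1 := mul_le_mul_of_nonneg_left (trunc_le_self (h := h) ht hu) (oddPow_nonneg (p := p) hu)
  rw [oddPow_mul_self hp hu] at h1
  unfold oddPow at h1
  rw [Ffun, trunc_zero ht, zero_rpow (by linarith), sub_zero, sub_zero]
  linarith

/-- **Lemma.** `F` is continuous on `[0,∞)²`, vanishes at the origin, is nonnegative, and is
supermodular: `F(u₂,v₂) + F(u₁,v₁) ≥ F(u₂,v₁) + F(u₁,v₂)` for `u₁ ≤ u₂`, `v₁ ≤ v₂`. -/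
theorem Ffun_properties (p t h : ℝ) (hp : 2 ≤ p) (ht : 0 < t) (hh : 0 < h) :
    ContinuousOn (fun q : ℝ × ℝ => Ffun p t h q.1 q.2) (Set.Ici (0 : ℝ) ×ˢ Set.Ici (0 : ℝ)) ∧
    Ffun p t h 0 0 = 0 ∧
    (∀ u v : ℝ, 0 ≤ u → 0 ≤ v → 0 ≤ Ffun p t h u v) ∧
    (∀ u₁ u₂ v₁ v₂ : ℝ, 0 ≤ u₁ → u₁ ≤ u₂ → 0 ≤ v₁ → v₁ ≤ v₂ →
      Ffun p t h u₂ v₁ + Ffun p t h u₁ v₂ ≤ Ffun p t h u₂ v₂ + Ffun p t h u₁ v₁) := by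
  have h00 : Ffun p t h 0 0 = 0 := by simp [Ffun, zero_rpow (by linarith : p ≠ 0)]
  refine ⟨Continuous.continuousOn ?_, h00, fun u v hu hv => ?_,
    fun u₁ u₂ v₁ v₂ _ hu _ hv => Ffun_supermodular hp hh hu hv⟩
  · have hG := continuous_trunc (t := t) hh
    have hpow : Continuous fun x : ℝ => x ^ p := continuous_id.rpow_const fun _ => .inr (by linarith)
    have habs : Continuous fun x : ℝ => |x| ^ (p - 2) :=
      continuous_abs.rpow_const fun _ => .inr (by linarith)
    unfold Ffun
    exact ((hpow.comp continuous_fst).add (hpow.comp continuous_snd)).sub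
      (((habs.comp (continuous_fst.sub continuous_snd)).mul (continuous_fst.sub continuous_snd)).mul
        ((hG.comp continuous_fst).sub (hG.comp continuous_snd)))
  · have h1 := Ffun_supermodular (t := t) hp hh hu hv
    have h2 := Ffun_zero_right_nonneg (h := h) hp ht hu
    have h3 := Ffun_zero_right_nonneg (h := h) hp ht hv
    rw [Ffun_comm] at h3
    linarith
end
end

section
/- Let N ≥ 1, s ∈ (0,1), p > 2, r > 0 and let w : ℝ^N → ℝ be measurable. Then ∫_{B_r}∫_{B_r^c} |w(x) − w(y)| / |x−y|^{N+2s} dx dy ≤ r^{(N−s)(p−2)/(p−1)} · P_s(B_1)^{(p−2)/(p−1)} · ( ∫_{B_r}∫_{B_r^c} |w(x) − w(y)|^{p−1} / |x−y|^{N+sp} dx dy )^{1/(p−1)}, where the double integrals of nonnegative integrands are taken in [0,∞] (the inequality being trivially true if the right-hand side integral is infinite). -/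
open MeasureTheory Real Set
open scoped ENNReal NNReal

noncomputable section

/-- The fractional `s`-perimeter of the unit ball,
`P_s(B_1) = ∫_{B_1}∫_{B_1^c} |x-y|^{-(N+s)} dx dy`. -/
def fracPer (N : ℕ) (s : ℝ) : ℝ≥0∞ :=
  ∫⁻ x in Metric.ball (0 : Euc N) 1, ∫⁻ y in (Metric.ball (0 : Euc N) 1)ᶜ,
    ENNReal.ofReal (‖x - y‖ ^ (-((N : ℝ) + s)))

/-- Change of variables `x ↦ r • x` for set integrals of nonnegative functions. -/
theorem setLIntegral_eq_mul_setLIntegral_comp_smul {E : Type*} [NormedAddCommGroup E]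
    [NormedSpace ℝ E] [FiniteDimensional ℝ E] [MeasurableSpace E] [BorelSpace E]
    (μ : Measure E) [μ.IsAddHaarMeasure] {r : ℝ} (hr : 0 < r) (S : Set E) (f : E → ℝ≥0∞) :
    ∫⁻ x in S, f x ∂μ =
      ENNReal.ofReal (r ^ Module.finrank ℝ E) * ∫⁻ x in (r • ·) ⁻¹' S, f (r • x) ∂μ := by
  have he : MeasurableEmbedding (fun x : E => r • x) := measurableEmbedding_const_smul₀ hr.ne'
  have hpos : 0 < r ^ Module.finrank ℝ E := by positivity
  rw [← he.lintegral_map, ← he.restrict_map, Measure.map_addHaar_smul μ hr.ne',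
    Measure.restrict_smul, lintegral_smul_measure, smul_eq_mul, ← mul_assoc,
    ← ENNReal.ofReal_mul hpos.le, abs_of_pos (by positivity), mul_inv_cancel₀ hpos.ne',
    ENNReal.ofReal_one, one_mul]

/-- The fractional perimeter is homogeneous of degree `N - s`. -/
theorem fracPer_ball (N : ℕ) (s : ℝ) {r : ℝ} (hr : 0 < r) :
    (∫⁻ x in Metric.ball (0 : Euc N) r, ∫⁻ y in (Metric.ball (0 : Euc N) r)ᶜ,
      ENNReal.ofReal (‖x - y‖ ^ (-((N : ℝ) + s)))) =
      ENNReal.ofReal (r ^ ((N : ℝ) - s)) * fracPer N s := by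
  have hball : (r • ·) ⁻¹' Metric.ball (0 : Euc N) r = Metric.ball (0 : Euc N) 1 := by
    ext x
    simp [norm_smul, abs_of_pos hr, hr]
  have hscale (x y : Euc N) : ENNReal.ofReal (‖r • x - r • y‖ ^ (-((N : ℝ) + s))) =
      ENNReal.ofReal (r ^ (-((N : ℝ) + s))) * ENNReal.ofReal (‖x - y‖ ^ (-((N : ℝ) + s))) := by
    rw [← smul_sub, norm_smul, Real.norm_of_nonneg hr.le, Real.mul_rpow hr.le (norm_nonneg _),
      ENNReal.ofReal_mul (by positivity)]
  have hpow : r ^ N * (r ^ N * r ^ (-((N : ℝ) + s))) = r ^ ((N : ℝ) - s) := by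
    rw [← Real.rpow_natCast, ← Real.rpow_add hr, ← Real.rpow_add hr]
    ring_nf
  rw [setLIntegral_eq_mul_setLIntegral_comp_smul volume hr, hball]
  simp only [setLIntegral_eq_mul_setLIntegral_comp_smul volume hr (Metric.ball (0 : Euc N) r)ᶜ,
    preimage_compl, hball, hscale, finrank_euclideanSpace, Fintype.card_fin]
  simp only [lintegral_const_mul' _ _ ENNReal.ofReal_ne_top]
  rw [fracPer, ← hpow, ENNReal.ofReal_mul (by positivity), ENNReal.ofReal_mul (by positivity)]
  simp only [mul_assoc]

/-- **Hölder-type inequality between nonlocal kernels.** -/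
theorem holder_kernel_inequality
    (N : ℕ) (hN : 1 ≤ N) (s p r : ℝ) (hs : s ∈ Set.Ioo (0 : ℝ) 1) (hp : 2 < p) (hr : 0 < r)
    (w : Euc N → ℝ) (hw : Measurable w) :
    (∫⁻ x in Metric.ball (0 : Euc N) r, ∫⁻ y in (Metric.ball (0 : Euc N) r)ᶜ,
        ENNReal.ofReal (|w x - w y| / ‖x - y‖ ^ ((N : ℝ) + 2 * s))) ≤
      ENNReal.ofReal (r ^ (((N : ℝ) - s) * (p - 2) / (p - 1))) *
        fracPer N s ^ ((p - 2) / (p - 1)) *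
        (∫⁻ x in Metric.ball (0 : Euc N) r, ∫⁻ y in (Metric.ball (0 : Euc N) r)ᶜ,
            ENNReal.ofReal (|w x - w y| ^ (p - 1) / ‖x - y‖ ^ ((N : ℝ) + s * p))) ^
          (1 / (p - 1)) := by
  have hp1 : 0 < p - 1 := by linarith
  have hp2 : 0 < p - 2 := by linarith
  have hconj : ((p - 1) / (p - 2)).HolderConjugate (p - 1) := by
    rw [Real.holderConjugate_iff]
    refine ⟨by rw [lt_div_iff₀ hp2]; linarith, ?_⟩
    field_simp
    ring
  set B := Metric.ball (0 : Euc N) r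
  have hB : MeasurableSet B := measurableSet_ball
  set μ : Measure (Euc N × Euc N) := (volume.restrict B).prod (volume.restrict Bᶜ) with hμ
  have hw1 : Measurable fun z : Euc N × Euc N => w z.1 := hw.comp measurable_fst
  have hw2 : Measurable fun z : Euc N × Euc N => w z.2 := hw.comp measurable_snd
  have hne : ∀ᵐ z ∂μ, 0 < ‖z.1 - z.2‖ := by
    rw [hμ, Measure.prod_restrict]
    filter_upwards [ae_restrict_mem (hB.prod hB.compl)] with z hz
    rw [norm_pos_iff, sub_ne_zero]
    intro h
    exact hz.2 (h ▸ hz.1)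
  let f : Euc N × Euc N → ℝ≥0∞ := fun z =>
    ENNReal.ofReal (‖z.1 - z.2‖ ^ (-(((N : ℝ) + s) * ((p - 2) / (p - 1)))))
  let g : Euc N × Euc N → ℝ≥0∞ := fun z =>
    ENNReal.ofReal (|w z.1 - w z.2| / ‖z.1 - z.2‖ ^ (((N : ℝ) + s * p) / (p - 1)))
  have hf : Measurable f := by fun_prop
  have hg : Measurable g := by fun_prop
  have key := ENNReal.lintegral_mul_le_Lp_mul_Lq μ hconj hf.aemeasurable hg.aemeasurable
  have hfg : ∫⁻ z, (f * g) z ∂μ = ∫⁻ x in B, ∫⁻ y in Bᶜ,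
      ENNReal.ofReal (|w x - w y| / ‖x - y‖ ^ ((N : ℝ) + 2 * s)) := by
    rw [← lintegral_prod (fun z : Euc N × Euc N =>
      ENNReal.ofReal (|w z.1 - w z.2| / ‖z.1 - z.2‖ ^ ((N : ℝ) + 2 * s))) (by fun_prop)]
    refine lintegral_congr_ae ?_
    filter_upwards [hne] with z hz
    have hexp : (N : ℝ) + 2 * s =
        (N + s) * ((p - 2) / (p - 1)) + (N + s * p) / (p - 1) := by
      field_simp
      ring
    rw [Pi.mul_apply, ← ENNReal.ofReal_mul (by positivity), hexp, Real.rpow_add hz,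
      Real.rpow_neg hz.le]
    congr 1
    field_simp
  have hfp : ∫⁻ z, f z ^ ((p - 1) / (p - 2)) ∂μ =
      ENNReal.ofReal (r ^ ((N : ℝ) - s)) * fracPer N s := by
    rw [← fracPer_ball N s hr, ← lintegral_prod (fun z : Euc N × Euc N =>
      ENNReal.ofReal (‖z.1 - z.2‖ ^ (-((N : ℝ) + s)))) (by fun_prop)]
    refine lintegral_congr fun z => ?_
    rw [ENNReal.ofReal_rpow_of_nonneg (by positivity) (by positivity),
      ← Real.rpow_mul (norm_nonneg _)]
    congr 2
    field_simp
  have hgq : ∫⁻ z, g z ^ (p - 1) ∂μ = ∫⁻ x in B, ∫⁻ y in Bᶜ,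
      ENNReal.ofReal (|w x - w y| ^ (p - 1) / ‖x - y‖ ^ ((N : ℝ) + s * p)) := by
    rw [← lintegral_prod (fun z : Euc N × Euc N =>
      ENNReal.ofReal (|w z.1 - w z.2| ^ (p - 1) / ‖z.1 - z.2‖ ^ ((N : ℝ) + s * p)))
      (by fun_prop)]
    refine lintegral_congr fun z => ?_
    rw [ENNReal.ofReal_rpow_of_nonneg (by positivity) hp1.le,
      Real.div_rpow (abs_nonneg _) (by positivity), ← Real.rpow_mul (norm_nonneg _),
      div_mul_cancel₀ _ hp1.ne']
  rw [hfg, hfp, hgq, one_div_div, ENNReal.mul_rpow_of_nonneg _ _ (by positivity),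
    ENNReal.ofReal_rpow_of_nonneg (by positivity) (by positivity), ← Real.rpow_mul hr.le,
    ← mul_div_assoc] at key
  exact key
end
end

section
/- Let N ≥ 1, s ∈ (0,1), p > 2 with sp < N, let Ω ⊂ ℝ^N be a bounded open set, and let pN/((p−1)N+sp) ≤ m < N/(sp). Let f be measurable on Ω, f ≥ 0, extended by 0 outside Ω, with ∫_{B_r} f^# dx > 0 for every r > 0, and with finite Lorentz norm ‖f‖_{L^{m,q*}(Ω)} where q* = Nm/(N+sm(p−2)). Define g as the radial function g(r) = H(N,s,p) r^{(N−s)(p−2)/(p−1)} [ ((N−s)(p−2)/(p−1)) r^{−N} (∫_{B_r} f^# dx)^{1/(p−1)} + (Nω_N/(p−1)) (∫_{B_r} f^# dx)^{(2−p)/(p−1)} f^#(x) ] for r = |x| > 0, and set t = Nm(p−1)/(N+sm(p−2)). Then there exists a constant C depending only on N, s, p, m such that ‖g‖_{L^t(Ω^#)} ≤ C ‖f‖_{L^{m,q*}(Ω)}^{1/(p−1)}, where Ω^# is the ball centered at the origin with |Ω^#| = |Ω|. -/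
open MeasureTheory Real Set
open scoped ENNReal NNReal

noncomputable section

/-- `ω_N = π^{N/2}/Γ(N/2+1)`, the volume of the unit ball of `ℝ^N`. -/
def omegaN (N : ℕ) : ℝ := Real.pi ^ ((N : ℝ) / 2) / Real.Gamma ((N : ℝ) / 2 + 1)

/-- Distribution function `μ_f(t) = |{x : |f x| > t}|`. -/
def distFun (N : ℕ) (f : Euc N → ℝ) (t : ℝ) : ℝ≥0∞ := volume {x : Euc N | t < |f x|}

/-- Decreasing rearrangement `f^*(σ) = sup {t ≥ 0 : μ_f(t) > σ}`. -/
def decRearr (N : ℕ) (f : Euc N → ℝ) (σ : ℝ) : ℝ :=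
  sSup {t : ℝ | 0 ≤ t ∧ ENNReal.ofReal σ < distFun N f t}

/-- Schwarz (radially decreasing) rearrangement `f^#(x) = f^*(ω_N |x|^N)`. -/
def schwarz (N : ℕ) (f : Euc N → ℝ) (x : Euc N) : ℝ :=
  decRearr N f (omegaN N * ‖x‖ ^ N)

/-- The normalization constant `γ(N,s,p)`. -/
def gammaC (N : ℕ) (s p : ℝ) : ℝ :=
  s * p * 2 ^ (2 * s - 2) * (1 - s) * Real.Gamma (((N : ℝ) + s * p) / 2) /
    (Real.pi ^ (((N : ℝ) - 1) / 2) * Real.Gamma ((p + 1) / 2) * Real.Gamma (2 - s))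

/-- The constant `H(N,s,p) = (γ(N,s,2)/(Nω_N)) P_s(B_1)^{(p-2)/(p-1)} / γ(N,s,p)^{1/(p-1)}`. -/
def Hc (N : ℕ) (s p : ℝ) : ℝ :=
  gammaC N s 2 / ((N : ℝ) * omegaN N) * (fracPer N s).toReal ^ ((p - 2) / (p - 1)) /
    gammaC N s p ^ (1 / (p - 1))

/-- `∫_{B_r} f^# dx`. -/
def ballInt (N : ℕ) (f : Euc N → ℝ) (r : ℝ) : ℝ :=
  ∫ x in Metric.ball (0 : Euc N) r, schwarz N f x

/-- The radial profile of the datum `g` of the symmetrized problem: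
`g(r) = H(N,s,p) r^{(N-s)(p-2)/(p-1)} [ ((N-s)(p-2)/(p-1)) r^{-N} (∫_{B_r} f^#)^{1/(p-1)}
  + (Nω_N/(p-1)) (∫_{B_r} f^#)^{(2-p)/(p-1)} f^#(r) ]`. -/
def gRad (N : ℕ) (s p : ℝ) (f : Euc N → ℝ) (r : ℝ) : ℝ :=
  Hc N s p * r ^ (((N : ℝ) - s) * (p - 2) / (p - 1)) *
    (((N : ℝ) - s) * (p - 2) / (p - 1) * r ^ (-(N : ℝ)) * ballInt N f r ^ (1 / (p - 1)) +
      (N : ℝ) * omegaN N / (p - 1) * ballInt N f r ^ ((2 - p) / (p - 1)) *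
        decRearr N f (omegaN N * r ^ N))

/-- The Lorentz norm `‖f‖_{L^{m,q}(Ω)}` defined through the maximal function of `f^*`. -/
def lorentzNorm (N : ℕ) (f : Euc N → ℝ) (Ω : Set (Euc N)) (m q : ℝ) : ℝ≥0∞ :=
  (∫⁻ σ in Set.Ioo (0 : ℝ) ((volume Ω).toReal),
      ENNReal.ofReal
        ((σ ^ (1 / m) * ((1 / σ) * ∫ τ in Set.Ioo (0 : ℝ) σ, decRearr N f τ)) ^ q / σ)) ^
    (1 / q)

lemma omegaN_pos (N : ℕ) : 0 < omegaN N :=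
  div_pos (rpow_pos_of_pos Real.pi_pos _) (Real.Gamma_pos_of_pos (by positivity))

lemma sqrt_pi_pow_div_Gamma_eq_omegaN (N : ℕ) :
    √Real.pi ^ N / Real.Gamma ((N : ℝ) / 2 + 1) = omegaN N := by
  rw [omegaN, Real.sqrt_eq_rpow, ← Real.rpow_natCast, ← Real.rpow_mul Real.pi_pos.le]
  ring_nf

lemma volume_ball_eq_omegaN {N : ℕ} (hN : 1 ≤ N) {r : ℝ} (hr : 0 ≤ r) :
    volume (Metric.ball (0 : Euc N) r) = ENNReal.ofReal (omegaN N * r ^ N) := by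
  have : Nonempty (Fin N) := ⟨⟨0, hN⟩⟩
  rw [EuclideanSpace.volume_ball, Fintype.card_fin, sqrt_pi_pow_div_Gamma_eq_omegaN, mul_comm,
    ← ENNReal.ofReal_pow hr, ← ENNReal.ofReal_mul (omegaN_pos N).le]

lemma volume_closedBall_eq_omegaN {N : ℕ} (hN : 1 ≤ N) {r : ℝ} (hr : 0 ≤ r) :
    volume (Metric.closedBall (0 : Euc N) r) = ENNReal.ofReal (omegaN N * r ^ N) := by
  have : Nonempty (Fin N) := ⟨⟨0, hN⟩⟩
  rw [EuclideanSpace.volume_closedBall, Fintype.card_fin, sqrt_pi_pow_div_Gamma_eq_omegaN,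
    mul_comm, ← ENNReal.ofReal_pow hr, ← ENNReal.ofReal_mul (omegaN_pos N).le]

lemma exists_pos_omegaN_mul_pow_eq {N : ℕ} (hN : 1 ≤ N) {σ : ℝ} (hσ : 0 < σ) :
    ∃ r > 0, omegaN N * r ^ N = σ := by
  have hω := omegaN_pos N
  refine ⟨(σ / omegaN N) ^ ((N : ℝ)⁻¹), by positivity, ?_⟩
  rw [Real.rpow_inv_natCast_pow (by positivity) (by omega)]
  field_simp

/-- The map `x ↦ ω_N ‖x‖ ^ N` pushes Lebesgue measure on a ball forward to Lebesgue measure on an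
interval of the same measure. -/
lemma map_omegaN_mul_norm_pow {N : ℕ} (hN : 1 ≤ N) {R : ℝ} (hR : 0 < R) :
    (volume.restrict (Metric.ball (0 : Euc N) R)).map (fun x => omegaN N * ‖x‖ ^ N) =
      volume.restrict (Ioo 0 (omegaN N * R ^ N)) := by
  have hω := omegaN_pos N
  have hφ : Measurable (fun x : Euc N => omegaN N * ‖x‖ ^ N) := by fun_prop
  have : IsFiniteMeasure (volume.restrict (Metric.ball (0 : Euc N) R)) :=
    isFiniteMeasure_restrict.mpr Metric.isBounded_ball.measure_lt_top.ne
  refine Measure.ext_of_Iic _ _ fun a => ?_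
  rw [Measure.map_apply hφ measurableSet_Iic,
    Measure.restrict_apply (hφ measurableSet_Iic), Measure.restrict_apply measurableSet_Iic]
  rcases le_or_gt a 0 with ha | ha
  · have h₁ : Iic a ∩ Ioo 0 (omegaN N * R ^ N) = ∅ := by
      ext x
      simp only [mem_inter_iff, mem_Iic, mem_Ioo, mem_empty_iff_false, iff_false]
      intro h
      linarith [h.1, h.2.1]
    have h₂ : ((fun x : Euc N => omegaN N * ‖x‖ ^ N) ⁻¹' Iic a) ∩ Metric.ball 0 R ⊆
        Metric.closedBall 0 0 := by
      rintro x ⟨hx, -⟩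
      simp only [mem_preimage, mem_Iic] at hx
      by_contra hx0
      simp only [Metric.closedBall_zero, mem_singleton_iff] at hx0
      have : 0 < omegaN N * ‖x‖ ^ N := by positivity
      linarith
    rw [h₁, measure_empty]
    refine measure_mono_null h₂ ?_
    rw [volume_closedBall_eq_omegaN hN le_rfl, zero_pow (by omega)]
    simp
  obtain ⟨ρ, hρ, rfl⟩ := exists_pos_omegaN_mul_pow_eq hN ha
  have hpre : ((fun x : Euc N => omegaN N * ‖x‖ ^ N) ⁻¹' Iic (omegaN N * ρ ^ N)) =
      Metric.closedBall 0 ρ := by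
    ext x
    simp only [mem_preimage, mem_Iic, mem_closedBall_zero_iff]
    rw [mul_le_mul_iff_right₀ hω, pow_le_pow_iff_left₀ (norm_nonneg x) hρ.le (by omega)]
  rw [hpre]
  rcases lt_or_ge ρ R with h | h
  · rw [inter_eq_left.mpr (Metric.closedBall_subset_ball h), volume_closedBall_eq_omegaN hN hρ.le]
    have hlt : omegaN N * ρ ^ N < omegaN N * R ^ N := by gcongr
    have : Iic (omegaN N * ρ ^ N) ∩ Ioo 0 (omegaN N * R ^ N) = Ioc 0 (omegaN N * ρ ^ N) := by
      ext x
      simp only [mem_inter_iff, mem_Iic, mem_Ioo, mem_Ioc]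
      exact ⟨fun h => ⟨h.2.1, h.1⟩, fun h => ⟨h.2, h.1, h.2.trans_lt hlt⟩⟩
    rw [this, Real.volume_Ioc, sub_zero]
  · have hle : omegaN N * R ^ N ≤ omegaN N * ρ ^ N := by gcongr
    rw [inter_eq_right.mpr
        (Metric.ball_subset_closedBall.trans (Metric.closedBall_subset_closedBall h)),
      volume_ball_eq_omegaN hN hR.le, inter_eq_right.mpr fun x hx => hx.2.le.trans hle,
      Real.volume_Ioo, sub_zero]

section Rearrangement

variable {N : ℕ} {f : Euc N → ℝ}

lemma decRearr_nonneg (σ : ℝ) : 0 ≤ decRearr N f σ :=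
  Real.sSup_nonneg fun _ ht => ht.1

lemma bddAbove_decRearr_set (hf : Measurable f) (hfin : distFun N f 0 ≠ ⊤) {σ : ℝ} (hσ : 0 < σ) :
    BddAbove {t : ℝ | 0 ≤ t ∧ ENNReal.ofReal σ < distFun N f t} := by
  have hlim := tendsto_measure_iInter_atTop (μ := volume) (s := fun t : ℝ => {x : Euc N | t < |f x|})
    (fun t => (measurableSet_lt measurable_const hf.abs).nullMeasurableSet)
    (fun a b hab x hx => lt_of_le_of_lt hab hx) ⟨0, hfin⟩
  have hempty : ⋂ t : ℝ, {x : Euc N | t < |f x|} = ∅ := by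
    refine eq_empty_of_forall_notMem fun x hx => ?_
    exact lt_irrefl |f x| (mem_iInter.mp hx |f x|)
  rw [hempty, measure_empty] at hlim
  obtain ⟨T, hT⟩ := (hlim.eventually_lt_const (ENNReal.ofReal_pos.mpr hσ)).exists
  refine ⟨T, fun t ht => ?_⟩
  by_contra! hlt
  have : distFun N f t ≤ distFun N f T := measure_mono fun x hx => lt_trans hlt hx
  exact absurd (ht.2.trans_le this) hT.not_gt

lemma antitoneOn_decRearr (hf : Measurable f) (hfin : distFun N f 0 ≠ ⊤) :
    AntitoneOn (decRearr N f) (Ioi 0) := by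
  intro a ha b hb hab
  rcases eq_empty_or_nonempty {t : ℝ | 0 ≤ t ∧ ENNReal.ofReal b < distFun N f t} with h | h
  · rw [decRearr, h, Real.sSup_empty]
    exact decRearr_nonneg a
  · exact csSup_le_csSup (bddAbove_decRearr_set hf hfin ha) h
      fun t ht => ⟨ht.1, (ENNReal.ofReal_le_ofReal hab).trans_lt ht.2⟩

lemma ballInt_eq_integral_decRearr (hN : 1 ≤ N) (hf : Measurable f) (hfin : distFun N f 0 ≠ ⊤)
    {r : ℝ} (hr : 0 < r) :
    ballInt N f r = ∫ τ in Ioo 0 (omegaN N * r ^ N), decRearr N f τ := by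
  have hmap := map_omegaN_mul_norm_pow hN hr
  have hφ : Measurable (fun x : Euc N => omegaN N * ‖x‖ ^ N) := by fun_prop
  rw [← hmap, integral_map hφ.aemeasurable]
  · rfl
  · rw [hmap]
    exact (aemeasurable_restrict_of_antitoneOn measurableSet_Ioo
      ((antitoneOn_decRearr hf hfin).mono fun x hx => hx.1)).aestronglyMeasurable

lemma integrableOn_decRearr (hN : 1 ≤ N) (hf : Measurable f) (hfin : distFun N f 0 ≠ ⊤)
    (hpos : ∀ r > 0, 0 < ballInt N f r) (σ : ℝ) :
    IntegrableOn (decRearr N f) (Ioo 0 σ) := by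
  rcases le_or_gt σ 0 with hσ | hσ
  · simp [Ioo_eq_empty hσ.not_gt]
  obtain ⟨r, hr, rfl⟩ := exists_pos_omegaN_mul_pow_eq hN hσ
  by_contra h
  have := hpos r hr
  rw [ballInt_eq_integral_decRearr hN hf hfin hr, integral_undef h] at this
  exact lt_irrefl _ this

lemma monotone_integral_decRearr (hint : ∀ σ, IntegrableOn (decRearr N f) (Ioo 0 σ)) :
    Monotone fun σ : ℝ => ∫ τ in Ioo 0 σ, decRearr N f τ := by
  intro a b hab
  exact setIntegral_mono_set (hint b) (Filter.Eventually.of_forall fun τ => decRearr_nonneg τ)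
    (Ioo_subset_Ioo_right hab).eventuallyLE

lemma decRearr_mul_le_integral (hf : Measurable f) (hfin : distFun N f 0 ≠ ⊤)
    {σ : ℝ} (hσ : 0 < σ) (hint : IntegrableOn (decRearr N f) (Ioo 0 σ)) :
    decRearr N f σ * σ ≤ ∫ τ in Ioo 0 σ, decRearr N f τ := by
  have h := setIntegral_ge_of_const_le_real (c := decRearr N f σ) measurableSet_Ioo
    (by simp) (fun τ hτ => antitoneOn_decRearr hf hfin hτ.1 hσ hτ.2.le) hint
  simpa [Measure.real, hσ.le] using h

end Rearrangement

/-- The constant in the pointwise bound of `gRad` by the maximal function of `f^*`. -/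
def gRadConst (N : ℕ) (s p : ℝ) : ℝ :=
  |Hc N s p| * (omegaN N ^ (((N : ℝ) - s) * (p - 2) / (p - 1) / N))⁻¹ *
    (((N : ℝ) - s) * (p - 2) / (p - 1) * omegaN N + (N : ℝ) * omegaN N / (p - 1))

lemma gRadConst_nonneg {N : ℕ} (hN : 1 ≤ N) {s p : ℝ} (hs : s < 1) (hp : 2 < p) :
    0 ≤ gRadConst N s p := by
  have hω := omegaN_pos N
  have hN' : (1 : ℝ) ≤ N := by exact_mod_cast hN
  have h₁ : 0 ≤ (N : ℝ) - s := by linarith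
  have h₂ : 0 ≤ p - 2 := by linarith
  have h₃ : 0 ≤ p - 1 := by linarith
  unfold gRadConst
  positivity

lemma abs_gRad_le {N : ℕ} (hN : 1 ≤ N) {s p : ℝ} (hs : s < 1) (hp : 2 < p) {f : Euc N → ℝ}
    {r : ℝ} (hr : 0 < r) (hF : 0 < ballInt N f r)
    (hle : decRearr N f (omegaN N * r ^ N) * (omegaN N * r ^ N) ≤ ballInt N f r) :
    |gRad N s p f r| ≤ gRadConst N s p *
      ((omegaN N * r ^ N) ^ (((N : ℝ) - s) * (p - 2) / (p - 1) / N - 1) *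
        ballInt N f r ^ (1 / (p - 1))) := by
  have hω := omegaN_pos N
  have hN' : (1 : ℝ) ≤ N := by exact_mod_cast hN
  have h₁ : 0 ≤ (N : ℝ) - s := by linarith
  have h₂ : 0 ≤ p - 2 := by linarith
  have h₃ : 0 < p - 1 := by linarith
  have hd := decRearr_nonneg (f := f) (omegaN N * r ^ N)
  rw [gRad, gRadConst]
  set e := ((N : ℝ) - s) * (p - 2) / (p - 1) with he
  have he0 : 0 ≤ e := by positivity
  set σ := omegaN N * r ^ N with hσ
  have hσ0 : 0 < σ := by positivity
  set F := ballInt N f r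
  set d := decRearr N f σ
  have hrN : r ^ (-(N : ℝ)) = omegaN N / σ := by
    rw [Real.rpow_neg hr.le, Real.rpow_natCast, hσ]
    field_simp
  have hre : r ^ e = (omegaN N ^ (e / N))⁻¹ * σ ^ (e / N) := by
    rw [hσ, Real.mul_rpow hω.le (by positivity), ← Real.rpow_natCast, ← Real.rpow_mul hr.le]
    rw [mul_div_cancel₀ e (by positivity)]
    field_simp
  have hFd : F ^ ((2 - p) / (p - 1)) * d ≤ F ^ (1 / (p - 1)) / σ := by
    rw [le_div_iff₀ hσ0, mul_assoc]
    calc F ^ ((2 - p) / (p - 1)) * (d * σ) ≤ F ^ ((2 - p) / (p - 1)) * F := by gcongr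
      _ = F ^ (1 / (p - 1)) := by
        rw [← Real.rpow_add_one hF.ne']
        congr 1
        field_simp
        ring
  rw [hrN, hre, Real.rpow_sub_one hσ0.ne']
  have hin : 0 ≤ e * (omegaN N / σ) * F ^ (1 / (p - 1)) +
      N * omegaN N / (p - 1) * F ^ ((2 - p) / (p - 1)) * d := by positivity
  rw [abs_mul, abs_of_nonneg hin, abs_mul, abs_of_nonneg (by positivity : (0 : ℝ) ≤
    (omegaN N ^ (e / N))⁻¹ * σ ^ (e / N))]
  calc _ ≤ |Hc N s p| * ((omegaN N ^ (e / N))⁻¹ * σ ^ (e / N)) *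
        (e * (omegaN N / σ) * F ^ (1 / (p - 1)) +
          N * omegaN N / (p - 1) * (F ^ (1 / (p - 1)) / σ)) := by
        rw [mul_assoc (N * omegaN N / (p - 1))]
        gcongr
    _ = _ := by ring

/-- Exponent bookkeeping: the `t`-th power of the pointwise bound is the Lorentz integrand. -/
lemma rpow_pointwise_bound_eq {N s p m σ F : ℝ} (hN : 0 < N) (hs : 0 < s) (hp : 2 < p) (hm : 0 < m)
    (hσ : 0 < σ) (hF : 0 < F) :
    (σ ^ ((N - s) * (p - 2) / (p - 1) / N - 1) * F ^ (1 / (p - 1))) ^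
        (N * m * (p - 1) / (N + s * m * (p - 2))) =
      (σ ^ (1 / m) * ((1 / σ) * F)) ^ (N * m / (N + s * m * (p - 2))) / σ := by
  have h₂ : 0 < p - 2 := by linarith
  have h₁ : 0 < p - 1 := by linarith
  have hD : 0 < N + s * m * (p - 2) := by positivity
  have hcomb : σ ^ (1 / m) * ((1 / σ) * F) = σ ^ (1 / m - 1) * F := by
    rw [Real.rpow_sub_one hσ.ne']
    ring
  rw [hcomb, Real.mul_rpow (by positivity) (by positivity),
    Real.mul_rpow (by positivity) (by positivity), ← Real.rpow_mul hσ.le, ← Real.rpow_mul hF.le,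
    ← Real.rpow_mul hσ.le,
    mul_div_right_comm (σ ^ ((1 / m - 1) * _)), ← Real.rpow_sub_one hσ.ne']
  congr 2
  · field_simp
    ring
  · field_simp

/-- **Lorentz estimate for `g`:** with `t = Nm(p-1)/(N+sm(p-2))` and `q* = Nm/(N+sm(p-2))`,
there is `C = C(N,s,p,m)` such that `‖g‖_{L^t(Ω^#)} ≤ C ‖f‖_{L^{m,q*}(Ω)}^{1/(p-1)}`. -/
theorem gRad_Lorentz_bound
    (N : ℕ) (hN : 1 ≤ N) (s p m : ℝ) (hs : s ∈ Set.Ioo (0 : ℝ) 1) (hp : 2 < p)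
    (hsp : s * p < (N : ℝ))
    (hm : p * N / ((p - 1) * N + s * p) ≤ m) (hm' : m < (N : ℝ) / (s * p)) :
    ∃ C > (0 : ℝ),
      ∀ Ω : Set (Euc N), IsOpen Ω → Bornology.IsBounded Ω →
      ∀ f : Euc N → ℝ, Measurable f → (∀ x, 0 ≤ f x) → (∀ x ∉ Ω, f x = 0) →
        (∀ r > (0 : ℝ), 0 < ballInt N f r) →
        lorentzNorm N f Ω m ((N : ℝ) * m / ((N : ℝ) + s * m * (p - 2))) < ⊤ →
      ∀ R : ℝ, volume (Metric.ball (0 : Euc N) R) = volume Ω →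
        eLpNorm (fun x : Euc N => gRad N s p f ‖x‖)
            (ENNReal.ofReal ((N : ℝ) * m * (p - 1) / ((N : ℝ) + s * m * (p - 2))))
            (volume.restrict (Metric.ball (0 : Euc N) R)) ≤
          ENNReal.ofReal
            (C * (lorentzNorm N f Ω m ((N : ℝ) * m / ((N : ℝ) + s * m * (p - 2)))).toReal ^
              (1 / (p - 1))) := by
  obtain ⟨hs0, hs1⟩ := hs
  have hN0 : (0 : ℝ) < N := by exact_mod_cast hN
  have h₂ : 0 < p - 2 := by linarith
  have h₁ : 0 < p - 1 := by linarith
  have hm0 : 0 < m := lt_of_lt_of_le (by positivity) hm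
  have hD : 0 < (N : ℝ) + s * m * (p - 2) := by positivity
  have hK := gRadConst_nonneg hN hs1 hp
  refine ⟨gRadConst N s p + 1, by positivity, ?_⟩
  intro Ω _ hΩb f hf _ hf0 hpos hL R hR
  set q := (N : ℝ) * m / ((N : ℝ) + s * m * (p - 2)) with hq
  set t := (N : ℝ) * m * (p - 1) / ((N : ℝ) + s * m * (p - 2)) with ht
  have hq0 : 0 < q := by positivity
  have ht0 : 0 < t := by positivity
  have htq : t = q * (p - 1) := by rw [ht, hq]; ring
  rcases le_or_gt R 0 with hR0 | hR0
  · simp [Metric.ball_eq_empty.mpr hR0]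
  have hfin : distFun N f 0 ≠ ⊤ := by
    refine ((measure_mono fun x hx => ?_).trans_lt hΩb.measure_lt_top).ne
    by_contra hxΩ
    simp [hf0 x hxΩ] at hx
  have hω := omegaN_pos N
  have hint := integrableOn_decRearr hN hf hfin hpos
  have hΩv : (volume Ω).toReal = omegaN N * R ^ N := by
    rw [← hR, volume_ball_eq_omegaN hN hR0.le, ENNReal.toReal_ofReal (by positivity)]
  have hφ : Measurable (fun x : Euc N => omegaN N * ‖x‖ ^ N) := by fun_prop
  set Φ : ℝ → ℝ≥0∞ := fun σ => ENNReal.ofReal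
    ((σ ^ (1 / m) * ((1 / σ) * ∫ τ in Set.Ioo (0 : ℝ) σ, decRearr N f τ)) ^ q / σ) with hΦ
  have hΦm : Measurable Φ := by
    have := (monotone_integral_decRearr hint).measurable
    fun_prop
  have hne : ∀ᵐ x ∂(volume.restrict (Metric.ball (0 : Euc N) R)), x ≠ 0 := by
    have : Nonempty (Fin N) := ⟨⟨0, hN⟩⟩
    exact ae_restrict_of_ae (Measure.ae_ne volume 0)
  have hbound : ∀ᵐ x ∂(volume.restrict (Metric.ball (0 : Euc N) R)),
      ‖gRad N s p f ‖x‖‖ₑ ^ t ≤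
        ENNReal.ofReal (gRadConst N s p) ^ t * Φ (omegaN N * ‖x‖ ^ N) := by
    filter_upwards [hne] with x hx
    have hr : 0 < ‖x‖ := norm_pos_iff.mpr hx
    have hσ : 0 < omegaN N * ‖x‖ ^ N := by positivity
    have hF := hpos _ hr
    have hFeq := ballInt_eq_integral_decRearr hN hf hfin hr
    have hle := abs_gRad_le hN hs1 hp hr hF
      (hFeq ▸ decRearr_mul_le_integral hf hfin hσ (hint _))
    have key := rpow_pointwise_bound_eq hN0 hs0 hp hm0 hσ hF
    rw [hΦ]
    simp only
    rw [← hFeq, ← key, Real.enorm_eq_ofReal_abs, ENNReal.ofReal_rpow_of_nonneg (abs_nonneg _) ht0.le,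
      ENNReal.ofReal_rpow_of_nonneg hK ht0.le, ← ENNReal.ofReal_mul (by positivity),
      ← Real.mul_rpow hK (by positivity)]
    gcongr
  have hlint : ∫⁻ x in Metric.ball (0 : Euc N) R, ‖gRad N s p f ‖x‖‖ₑ ^ t ≤
      ENNReal.ofReal (gRadConst N s p) ^ t * ∫⁻ σ in Ioo 0 (omegaN N * R ^ N), Φ σ := by
    rw [← map_omegaN_mul_norm_pow hN hR0, lintegral_map hΦm hφ,
      ← lintegral_const_mul _ (by fun_prop)]
    exact lintegral_mono_ae hbound
  have hLeq : lorentzNorm N f Ω m q = (∫⁻ σ in Ioo 0 (omegaN N * R ^ N), Φ σ) ^ (1 / q) := by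
    rw [lorentzNorm, hΩv]
  rw [eLpNorm_eq_lintegral_rpow_enorm_toReal (by simpa using ht0) ENNReal.ofReal_ne_top,
    ENNReal.toReal_ofReal ht0.le]
  calc _ ≤ (ENNReal.ofReal (gRadConst N s p) ^ t *
        ∫⁻ σ in Ioo 0 (omegaN N * R ^ N), Φ σ) ^ (1 / t) := by gcongr
    _ = ENNReal.ofReal (gRadConst N s p) * lorentzNorm N f Ω m q ^ (1 / (p - 1)) := by
      rw [ENNReal.mul_rpow_of_nonneg _ _ (by positivity), ← ENNReal.rpow_mul,
        mul_one_div_cancel ht0.ne', ENNReal.rpow_one, hLeq, ← ENNReal.rpow_mul, htq,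
        one_div_mul_one_div]
    _ ≤ _ := by
      rw [ENNReal.ofReal_mul (by positivity), ← ENNReal.ofReal_rpow_of_nonneg
        ENNReal.toReal_nonneg (by positivity), ENNReal.ofReal_toReal hL.ne]
      gcongr
      linarith
end
end
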